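/- arXiv:2204.01859 — 8 statements merged into one kernel-verified Lean document; each statement's English description precedes it below -/
import Mathlib

section
/- Let 0 < e_0 ≤ 1, let m ≥ 1, and for each i ∈ Fin m let A_i : ℝ → ℝ satisfy A_i(0) = 0 and e_0·(t − s) ≤ A_i(t) − A_i(s) ≤ t − s for all 0 ≤ s ≤ t, with finish-time function g_i(w) = sInf {t ≥ 0 : A_i(t) ≥ w}. Let p : Fin n → ℝ with p_j > 0 for all j. For an assignment σ : Fin n → Fin m let L_i(σ) = ∑_{j : σ j = i} p_j, C_max(σ) = max_i g_i(L_i(σ)), and let C* = min over all assignments σ of C_max(σ). Let C*_full = min over all assignments σ of max_i L_i(σ). If α ≥ 1 and σ is an assignment with max_i L_i(σ) ≤ α·C*_full, then C_max(σ) ≤ (α/e_0)·C*. -/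
noncomputable def finish (A : ℝ → ℝ) (w : ℝ) : ℝ := sInf {t : ℝ | 0 ≤ t ∧ w ≤ A t}

noncomputable def load {n m : ℕ} (p : Fin n → ℝ) (σ : Fin n → Fin m) (i : Fin m) : ℝ :=
  ∑ j ∈ Finset.univ.filter (fun j => σ j = i), p j

noncomputable def prefLoad {n m : ℕ} (p : Fin n → ℝ) (σ : Fin n → Fin m) (i : Fin m)
    (k : Fin n) : ℝ :=
  ∑ j ∈ Finset.univ.filter (fun j => j < k ∧ σ j = i), p j

noncomputable def makespan {n m : ℕ} (hm : 0 < m) (A : Fin m → ℝ → ℝ) (p : Fin n → ℝ)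
    (σ : Fin n → Fin m) : ℝ :=
  Finset.univ.sup' ⟨⟨0, hm⟩, Finset.mem_univ _⟩ (fun i => finish (A i) (load p σ i))

noncomputable def optMakespan {n m : ℕ} (hm : 0 < m) (A : Fin m → ℝ → ℝ) (p : Fin n → ℝ) : ℝ :=
  Finset.univ.inf' ⟨fun _ => ⟨0, hm⟩, Finset.mem_univ _⟩ (makespan hm A p)

theorem finish_le_div {A : ℝ → ℝ} {e w : ℝ} (he : 0 < e) (hA : ∀ t, 0 ≤ t → e * t ≤ A t)
    (hw : 0 ≤ w) : finish A w ≤ w / e := by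
  have ht : 0 ≤ w / e := by positivity
  refine csInf_le ⟨0, fun t h => h.1⟩ ⟨ht, ?_⟩
  simpa [mul_div_cancel₀ w he.ne'] using hA _ ht

theorem le_finish {A : ℝ → ℝ} {e w : ℝ} (he : 0 < e) (hA : ∀ t, 0 ≤ t → e * t ≤ A t)
    (hA' : ∀ t, 0 ≤ t → A t ≤ t) (hw : 0 ≤ w) : w ≤ finish A w := by
  have ht : 0 ≤ w / e := by positivity
  refine le_csInf ⟨w / e, ht, ?_⟩ fun t h => h.2.trans (hA' t h.1)
  simpa [mul_div_cancel₀ w he.ne'] using hA _ ht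

theorem load_nonneg {n m : ℕ} {p : Fin n → ℝ} (hp : ∀ j, 0 ≤ p j) (σ : Fin n → Fin m)
    (i : Fin m) : 0 ≤ load p σ i :=
  Finset.sum_nonneg fun j _ => hp j

theorem stmt_1 (e0 : ℝ) (he0 : 0 < e0) (he0' : e0 ≤ 1)
    (m n : ℕ) (hm : 0 < m)
    (A : Fin m → ℝ → ℝ) (hA0 : ∀ i, A i 0 = 0)
    (hA : ∀ i, ∀ s t : ℝ, 0 ≤ s → s ≤ t →
      e0 * (t - s) ≤ A i t - A i s ∧ A i t - A i s ≤ t - s)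
    (p : Fin n → ℝ) (hp : ∀ j, 0 < p j)
    (α : ℝ) (hα : 1 ≤ α) (σ : Fin n → Fin m)
    (hσ : Finset.univ.sup' ⟨⟨0, hm⟩, Finset.mem_univ _⟩ (load p σ)
        ≤ α * Finset.univ.inf' ⟨fun _ => ⟨0, hm⟩, Finset.mem_univ _⟩
            (fun τ : Fin n → Fin m =>
              Finset.univ.sup' ⟨⟨0, hm⟩, Finset.mem_univ _⟩ (load p τ))) :
    makespan hm A p σ ≤ (α / e0) * optMakespan hm A p := by
  have hlow : ∀ i t, 0 ≤ t → e0 * t ≤ A i t := fun i t ht => by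
    simpa [hA0] using (hA i 0 t le_rfl ht).1
  have hupp : ∀ i t, 0 ≤ t → A i t ≤ t := fun i t ht => by
    simpa [hA0] using (hA i 0 t le_rfl ht).2
  have hload := load_nonneg (m := m) fun j => (hp j).le
  have hopt : Finset.univ.inf' ⟨fun _ => ⟨0, hm⟩, Finset.mem_univ _⟩
      (fun τ : Fin n → Fin m => Finset.univ.sup' ⟨⟨0, hm⟩, Finset.mem_univ _⟩ (load p τ))
      ≤ optMakespan hm A p :=
    Finset.inf'_mono_fun fun τ _ => Finset.sup'_mono_fun fun i _ =>
      le_finish he0 (hlow i) (hupp i) (hload τ i)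
  refine Finset.sup'_le _ _ fun i hi => ?_
  calc finish (A i) (load p σ i)
      ≤ load p σ i / e0 := finish_le_div he0 (hlow i) (hload σ i)
    _ ≤ α * optMakespan hm A p / e0 := by
        gcongr
        exact (Finset.le_sup' (load p σ) hi).trans (hσ.trans (by gcongr))
    _ = α / e0 * optMakespan hm A p := by ring
end

section
/- Let a : Fin n → ℕ with a_j ≥ 1 for all j, let A = ∑_j a_j be even, and let f > 1 be a real number. Let Ā : ℝ → ℝ be defined by Ā(t) = t for 0 ≤ t ≤ A/2, Ā(t) = A/2 + (t − A/2)/(f·A) for A/2 ≤ t ≤ A/2 + f·A, and Ā(t) = A/2 + 1 + (t − A/2 − f·A) for t ≥ A/2 + f·A, and let g(w) = sInf {t ≥ 0 : Ā(t) ≥ w}. Then there exists an assignment σ : Fin n → Fin 2 with max_{i ∈ Fin 2} g(∑_{j : σ j = i} a_j) ≤ (A/2)·f if and only if there exists a subset T ⊆ Fin n with ∑_{j ∈ T} a_j = A/2. -/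
theorem stmt_3 (n : ℕ) (a : Fin n → ℕ) (ha : ∀ j, 1 ≤ a j)
    (A : ℕ) (hA : A = ∑ j, a j) (hAeven : Even A)
    (f : ℝ) (hf : 1 < f)
    (Abar : ℝ → ℝ)
    (h1 : ∀ t : ℝ, 0 ≤ t → t ≤ (A : ℝ) / 2 → Abar t = t)
    (h2 : ∀ t : ℝ, (A : ℝ) / 2 ≤ t → t ≤ (A : ℝ) / 2 + f * A →
      Abar t = (A : ℝ) / 2 + (t - (A : ℝ) / 2) / (f * A))
    (h3 : ∀ t : ℝ, (A : ℝ) / 2 + f * A ≤ t →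
      Abar t = (A : ℝ) / 2 + 1 + (t - (A : ℝ) / 2 - f * A))
    (g : ℝ → ℝ) (hg : ∀ w : ℝ, g w = sInf {t : ℝ | 0 ≤ t ∧ w ≤ Abar t}) :
    (∃ σ : Fin n → Fin 2,
        Finset.univ.sup' Finset.univ_nonempty
          (fun i => g (∑ j ∈ Finset.univ.filter (fun j => σ j = i), (a j : ℝ)))
          ≤ (A : ℝ) / 2 * f)
      ↔ ∃ T : Finset (Fin n), ∑ j ∈ T, (a j : ℝ) = (A : ℝ) / 2 := by
  obtain ⟨k, hk⟩ := hAeven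
  have hkA : (A : ℝ) / 2 = k := by rw [hk]; push_cast; ring
  have hfA : 0 ≤ f * (A : ℝ) := by positivity
  have hA0 : (0 : ℝ) < A := by
    rcases Nat.eq_zero_or_pos A with h | h
    · subst h
      have e1 := h1 0 le_rfl (by simp)
      have e3 := h3 0 (by simp)
      simp at e1 e3
      linarith
    · exact_mod_cast h
  have hfA_pos : 0 < f * (A : ℝ) := by positivity
  have hbdd (w : ℝ) : BddBelow {t : ℝ | 0 ≤ t ∧ w ≤ Abar t} := ⟨0, fun t ht => ht.1⟩
  have hsplit (σ : Fin n → Fin 2) :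
      ∑ j ∈ Finset.univ.filter (fun j => σ j = 0), a j
        + ∑ j ∈ Finset.univ.filter (fun j => σ j = 1), a j = A := by
    rw [hA, ← Finset.sum_fiberwise Finset.univ σ a, Fin.sum_univ_two]
  constructor
  · rintro ⟨σ, hσ⟩
    have hload (i : Fin 2) : ∑ j ∈ Finset.univ.filter (fun j => σ j = i), a j ≤ k := by
      by_contra! hlt
      have hgi := (Finset.sup'_le_iff _ _).1 hσ i (Finset.mem_univ i)
      have hw : (A : ℝ) / 2 + 1 ≤ ∑ j ∈ Finset.univ.filter (fun j => σ j = i), (a j : ℝ) := by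
        rw [hkA]
        exact_mod_cast hlt
      rw [hg] at hgi
      generalize ∑ j ∈ Finset.univ.filter (fun j => σ j = i), (a j : ℝ) = w at hw hgi
      have hle : (A : ℝ) / 2 + f * A ≤ sInf {t : ℝ | 0 ≤ t ∧ w ≤ Abar t} := by
        refine le_csInf ⟨w - 1 + f * A, by linarith, ?_⟩ ?_
        · rw [h3 _ (by linarith)]
          linarith
        · rintro t ⟨ht0, htw⟩
          by_contra! hlt'
          rcases le_total t ((A : ℝ) / 2) with h | h
          · rw [h1 t ht0 h] at htw
            linarith
          · rw [h2 t h hlt'.le] at htw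
            have : (t - (A : ℝ) / 2) / (f * A) < 1 := by
              rw [div_lt_one hfA_pos]
              linarith
            linarith
      nlinarith
    refine ⟨Finset.univ.filter (fun j => σ j = 0), ?_⟩
    have h0 := hload 0
    have h1' := hload 1
    have hs := hsplit σ
    have : ∑ j ∈ Finset.univ.filter (fun j => σ j = 0), a j = k := by omega
    rw [hkA]
    exact_mod_cast this
  · rintro ⟨T, hT⟩
    refine ⟨fun j => if j ∈ T then 0 else 1, Finset.sup'_le _ _ fun i _ => ?_⟩
    have hs := hsplit fun j => if j ∈ T then 0 else 1
    have hT0 : ∑ j ∈ Finset.univ.filter (fun j => (if j ∈ T then (0 : Fin 2) else 1) = 0), a j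
        = k := by
      rw [hkA] at hT
      have hT' : ∑ j ∈ T, a j = k := by exact_mod_cast hT
      rw [← hT']
      congr 1
      ext j
      simp
    have hi : ∑ j ∈ Finset.univ.filter (fun j => (if j ∈ T then (0 : Fin 2) else 1) = i), (a j : ℝ)
        = (A : ℝ) / 2 := by
      rw [hkA]
      norm_cast
      fin_cases i
      · exact hT0
      · change ∑ j ∈ Finset.univ.filter (fun j => (if j ∈ T then (0 : Fin 2) else 1) = 1), a j = k
        omega
    rw [hi, hg]
    have hmem : sInf {t : ℝ | 0 ≤ t ∧ (A : ℝ) / 2 ≤ Abar t} ≤ (A : ℝ) / 2 :=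
      csInf_le (hbdd _) ⟨by positivity, (h1 _ (by positivity) le_rfl).ge⟩
    nlinarith
end

section
/- Let 0 < e_0 ≤ 1, m ≥ 1, and for each i ∈ Fin m let A_i : ℝ → ℝ satisfy A_i(0) = 0 and e_0·(t − s) ≤ A_i(t) − A_i(s) ≤ t − s for all 0 ≤ s ≤ t, with finish-time function g_i(w) = sInf {t ≥ 0 : A_i(t) ≥ w}. Let p : Fin n → ℝ with p_j > 0 for all j. Suppose σ : Fin n → Fin m is a list schedule for the job order 1, …, n, i.e., for every job k and every machine i, g_{σ k}(L_{σ k}^{<k}(σ)) ≤ g_i(L_i^{<k}(σ)), where L_i^{<k}(σ) = ∑_{j < k, σ j = i} p_j. Then C_max(σ) ≤ (1 + 1/e_0)·C*, where C_max(σ) = max_i g_i(∑_{j : σ j = i} p_j) and C* is the minimum of C_max over all assignments. -/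
theorem finish_le {A : ℝ → ℝ} {w t : ℝ} (ht : 0 ≤ t) (hw : w ≤ A t) : finish A w ≤ t :=
  csInf_le ⟨0, fun _ hx => hx.1⟩ ⟨ht, hw⟩

theorem finish_nonneg (A : ℝ → ℝ) (w : ℝ) : 0 ≤ finish A w :=
  Real.sInf_nonneg fun _ hx => hx.1

/-- A capacity function attains every nonnegative load exactly at its finish time. -/
theorem apply_finish {e0 : ℝ} (he0 : 0 < e0) {A : ℝ → ℝ} (hA0 : A 0 = 0)
    (hA : ∀ s t : ℝ, 0 ≤ s → s ≤ t → e0 * (t - s) ≤ A t - A s ∧ A t - A s ≤ t - s)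
    {w : ℝ} (hw : 0 ≤ w) : A (finish A w) = w := by
  have hT : 0 ≤ w / e0 := by positivity
  have hmono : MonotoneOn A (Set.Ici 0) := fun s hs t _ hst => by
    nlinarith [(hA s t hs hst).1, mul_nonneg he0.le (sub_nonneg.2 hst)]
  have hcont : ContinuousOn A (Set.Icc 0 (w / e0)) := by
    have hlip : LipschitzOnWith 1 A (Set.Icc 0 (w / e0)) := by
      refine LipschitzOnWith.of_le_add fun x hx y hy => ?_
      rw [Real.dist_eq]
      rcases le_total x y with h | h
      · linarith [hmono hx.1 hy.1 h, abs_nonneg (x - y)]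
      · linarith [(hA y x hy.1 h).2, le_abs_self (x - y)]
    exact hlip.continuousOn
  have hwT : w ≤ A (w / e0) := by
    have h := (hA 0 (w / e0) le_rfl hT).1
    rw [hA0, sub_zero, sub_zero, mul_div_cancel₀ _ he0.ne'] at h
    exact h
  obtain ⟨t, ht, rfl⟩ := intermediate_value_Icc hT hcont ⟨hA0.trans_le hw, hwT⟩
  have hle : finish A (A t) ≤ t := finish_le ht.1 le_rfl
  have hge : t ≤ finish A (A t) := by
    refine le_csInf ⟨t, ht.1, le_rfl⟩ fun x hx => ?_
    by_contra! hxt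
    nlinarith [(hA x t hx.1 hxt.le).1, hx.2, mul_pos he0 (sub_pos.2 hxt)]
  rw [le_antisymm hle hge]

theorem sum_load {n m : ℕ} (p : Fin n → ℝ) (σ : Fin n → Fin m) :
    ∑ i, load p σ i = ∑ j, p j :=
  Finset.sum_fiberwise _ _ _

theorem sum_prefLoad {n m : ℕ} (p : Fin n → ℝ) (σ : Fin n → Fin m) (k : Fin n) :
    ∑ i, prefLoad p σ i k = ∑ j ∈ Finset.univ.filter (· < k), p j := by
  simp only [prefLoad, ← Finset.filter_filter]
  exact Finset.sum_fiberwise _ _ _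

/-- A nonempty machine's load is that of its last job added to the load preceding that job. -/
theorem exists_load_eq_prefLoad_add {n m : ℕ} (p : Fin n → ℝ) (σ : Fin n → Fin m) (i : Fin m)
    (h : (Finset.univ.filter (fun j => σ j = i)).Nonempty) :
    ∃ k, σ k = i ∧ load p σ i = prefLoad p σ i k + p k := by
  obtain ⟨k, hk, hmax⟩ := Finset.exists_max_image _ id h
  have hki : σ k = i := (Finset.mem_filter.1 hk).2
  refine ⟨k, hki, ?_⟩
  rw [load, prefLoad, ← Finset.sum_erase_add _ _ hk]
  congr 2
  ext j
  simp only [Finset.mem_erase, Finset.mem_filter, Finset.mem_univ, true_and]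
  exact ⟨fun hj => ⟨lt_of_le_of_ne (hmax j (by simp [hj.2])) hj.1, hj.2⟩,
    fun hj => ⟨hj.1.ne, hj.2⟩⟩

theorem stmt_6 (e0 : ℝ) (he0 : 0 < e0) (he0' : e0 ≤ 1)
    (m n : ℕ) (hm : 0 < m)
    (A : Fin m → ℝ → ℝ) (hA0 : ∀ i, A i 0 = 0)
    (hA : ∀ i, ∀ s t : ℝ, 0 ≤ s → s ≤ t →
      e0 * (t - s) ≤ A i t - A i s ∧ A i t - A i s ≤ t - s)
    (p : Fin n → ℝ) (hp : ∀ j, 0 < p j)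
    (σ : Fin n → Fin m)
    (hLS : ∀ k : Fin n, ∀ i : Fin m,
      finish (A (σ k)) (prefLoad p σ (σ k) k) ≤ finish (A i) (prefLoad p σ i k)) :
    makespan hm A p σ ≤ (1 + 1 / e0) * optMakespan hm A p := by
  have hmono : ∀ i, ∀ s t : ℝ, 0 ≤ s → s ≤ t → A i s ≤ A i t := fun i s t hs hst => by
    nlinarith [(hA i s t hs hst).1, mul_nonneg he0.le (sub_nonneg.2 hst)]
  have hload : ∀ (τ : Fin n → Fin m) i, 0 ≤ load p τ i := fun τ i =>
    Finset.sum_nonneg fun j _ => (hp j).le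
  have hpref : ∀ i k, 0 ≤ prefLoad p σ i k := fun i k =>
    Finset.sum_nonneg fun j _ => (hp j).le
  obtain ⟨τ, -, hτ⟩ := Finset.exists_mem_eq_inf'
    (⟨fun _ => ⟨0, hm⟩, Finset.mem_univ _⟩ : (Finset.univ : Finset (Fin n → Fin m)).Nonempty)
    (makespan hm A p)
  rw [optMakespan, hτ]
  set C := makespan hm A p τ with hC
  have hfin : ∀ i, finish (A i) (load p τ i) ≤ C := fun i =>
    Finset.le_sup' (fun i => finish (A i) (load p τ i)) (Finset.mem_univ i)
  have hC0 : 0 ≤ C := (finish_nonneg _ _).trans (hfin ⟨0, hm⟩)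
  have hcap : ∀ i, load p τ i ≤ A i C := fun i => by
    rw [← apply_finish he0 (hA0 i) (hA i) (hload τ i)]
    exact hmono i _ _ (finish_nonneg _ _) (hfin i)
  refine Finset.sup'_le _ _ fun i _ => ?_
  rcases (Finset.univ.filter (fun j => σ j = i)).eq_empty_or_nonempty with h | h
  · have h0 : load p σ i = 0 := by rw [load, h, Finset.sum_empty]
    rw [h0]
    exact (finish_le le_rfl (hA0 i).ge).trans (by positivity)
  obtain ⟨k, rfl, hk⟩ := exists_load_eq_prefLoad_add p σ i h
  set S := finish (A (σ k)) (prefLoad p σ (σ k) k) with hS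
  have hS0 : 0 ≤ S := finish_nonneg _ _
  have hSC : S ≤ C := by
    by_contra! hlt
    have h1 : ∑ j, p j ≤ ∑ j ∈ Finset.univ.filter (· < k), p j := by
      rw [← sum_load p τ, ← sum_prefLoad p σ k]
      refine Finset.sum_le_sum fun i _ => (hcap i).trans ?_
      rw [← apply_finish he0 (hA0 i) (hA i) (hpref i k)]
      exact hmono i _ _ hC0 (hlt.le.trans (hLS k i))
    have h2 : ∑ j ∈ Finset.univ.filter (· < k), p j < ∑ j, p j :=
      Finset.sum_lt_sum_of_subset (Finset.filter_subset _ _) (Finset.mem_univ k) (by simp)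
        (hp k) fun j _ _ => (hp j).le
    exact h1.not_gt h2
  have hpC : p k ≤ C := by
    have h1 : p k ≤ load p τ (τ k) :=
      Finset.single_le_sum (f := p) (fun j _ => (hp j).le) (by simp)
    have h2 := (hA (τ k) 0 C le_rfl hC0).2
    rw [hA0] at h2
    linarith [hcap (τ k)]
  have hq : 0 ≤ p k / e0 := div_nonneg (hp k).le he0.le
  calc finish (A (σ k)) (load p σ (σ k)) ≤ S + p k / e0 := by
        refine finish_le (add_nonneg hS0 hq) ?_
        have h1 := (hA (σ k) S (S + p k / e0) hS0 (le_add_of_nonneg_right hq)).1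
        rw [add_sub_cancel_left, mul_div_cancel₀ _ he0.ne', hS,
          apply_finish he0 (hA0 _) (hA _) (hpref _ k)] at h1
        rw [hk, hS]
        linarith
    _ ≤ C + C / e0 := by gcongr
    _ = (1 + 1 / e0) * C := by ring
end

section
/- Let 0 < e_0 ≤ 1, 1 ≤ m_1 ≤ m. For i ∈ Fin m with i < m_1 let A_i : ℝ → ℝ satisfy A_i(0) = 0 and e_0·(t − s) ≤ A_i(t) − A_i(s) ≤ t − s for all 0 ≤ s ≤ t; for the remaining i let A_i satisfy A_i(0) = 0, A_i(t) − A_i(s) ≤ t − s for 0 ≤ s ≤ t, A_i strictly increasing, and A_i(t) → ∞. Let g_i(w) = sInf {t ≥ 0 : A_i(t) ≥ w} and let p : Fin n → ℝ with p_j > 0. If σ : Fin n → Fin m is an ECT schedule for the order 1, …, n (for every job k and machine i, g_{σ k}(L_{σ k}^{<k}(σ) + p_k) ≤ g_i(L_i^{<k}(σ) + p_k), where L_i^{<k}(σ) = ∑_{j < k, σ j = i} p_j), then C_max(σ) ≤ (1 + (⌊(m−1)/m_1⌋ + 1)/e_0)·C*, where C_max(σ) = max_i g_i(∑_{j : σ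 j = i} p_j) and C* is the minimum of C_max over all assignments. -/
/-- A capacity function reaches the work `w` at the finish time of `w`. -/
theorem le_apply_finish {A : ℝ → ℝ} {w : ℝ}
    (hub : ∀ s t : ℝ, 0 ≤ s → s ≤ t → A t - A s ≤ t - s)
    (hne : ∃ t, 0 ≤ t ∧ w ≤ A t) : w ≤ A (finish A w) := by
  by_contra! h
  obtain ⟨t, ht, hlt⟩ := exists_lt_of_csInf_lt (s := {t : ℝ | 0 ≤ t ∧ w ≤ A t}) hne
    (show finish A w < finish A w + (w - A (finish A w)) by linarith)
  have := hub _ t (finish_nonneg A w) (finish_le ht.1 ht.2)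
  linarith [ht.2]

/-- Up to the finish time of `w`, a capacity function does not exceed `w`. -/
theorem apply_le_of_le_finish {A : ℝ → ℝ} {w c : ℝ} (h0 : A 0 = 0)
    (hub : ∀ s t : ℝ, 0 ≤ s → s ≤ t → A t - A s ≤ t - s)
    (hw : 0 ≤ w) (hc : 0 ≤ c) (hcw : c ≤ finish A w) : A c ≤ w := by
  by_contra! h
  have h1 := hub 0 c le_rfl hc
  have h2 : 0 ≤ c - (A c - w) := by linarith
  have h3 := hub _ c h2 (by linarith)
  have h4 : finish A w ≤ c - (A c - w) := finish_le h2 (by linarith)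
  linarith

theorem prefLoad_nonneg {n m : ℕ} {p : Fin n → ℝ} (hp : ∀ j, 0 < p j) (σ : Fin n → Fin m)
    (i : Fin m) (k : Fin n) : 0 ≤ prefLoad p σ i k :=
  Finset.sum_nonneg fun j _ => (hp j).le

theorem sum_prefLoad_add_le {n m : ℕ} {p : Fin n → ℝ} (hp : ∀ j, 0 < p j)
    (σ : Fin n → Fin m) (k : Fin n) :
    ∑ i, prefLoad p σ i k + p k ≤ ∑ j, p j := by
  have h : ∑ i, prefLoad p σ i k = ∑ j ∈ Finset.univ.filter (fun j => j < k), p j := by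
    rw [← Finset.sum_fiberwise _ σ]
    simp only [prefLoad, Finset.filter_filter]
  rw [h, add_comm, ← Finset.sum_insert (by simp)]
  exact Finset.sum_le_sum_of_subset_of_nonneg (Finset.subset_univ _) fun j _ _ => (hp j).le

theorem le_load {n m : ℕ} {p : Fin n → ℝ} (hp : ∀ j, 0 < p j) (σ : Fin n → Fin m)
    (j : Fin n) : p j ≤ load p σ (σ j) :=
  Finset.single_le_sum (f := p) (fun j _ => (hp j).le) (by simp)

theorem stmt_8 (e0 : ℝ) (he0 : 0 < e0) (he0' : e0 ≤ 1)
    (m m1 n : ℕ) (hm1 : 1 ≤ m1) (hm1m : m1 ≤ m)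
    (A : Fin m → ℝ → ℝ) (hA0 : ∀ i, A i 0 = 0)
    (hAub : ∀ i, ∀ s t : ℝ, 0 ≤ s → s ≤ t → A i t - A i s ≤ t - s)
    (hAlo : ∀ i : Fin m, (i : ℕ) < m1 →
      ∀ s t : ℝ, 0 ≤ s → s ≤ t → e0 * (t - s) ≤ A i t - A i s)
    (hmono : ∀ i : Fin m, m1 ≤ (i : ℕ) → StrictMonoOn (A i) (Set.Ici (0 : ℝ)))
    (htop : ∀ i : Fin m, m1 ≤ (i : ℕ) → Filter.Tendsto (A i) Filter.atTop Filter.atTop)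
    (p : Fin n → ℝ) (hp : ∀ j, 0 < p j)
    (σ : Fin n → Fin m)
    (hECT : ∀ k : Fin n, ∀ i : Fin m,
      finish (A (σ k)) (prefLoad p σ (σ k) k + p k) ≤ finish (A i) (prefLoad p σ i k + p k)) :
    makespan (lt_of_lt_of_le hm1 hm1m) A p σ
      ≤ (1 + (((m - 1) / m1 + 1 : ℕ) : ℝ) / e0) * optMakespan (lt_of_lt_of_le hm1 hm1m) A p := by
  have hmon : ∀ i, MonotoneOn (A i) (Set.Ici 0) := fun i => by
    rcases lt_or_ge (i : ℕ) m1 with hi | hi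
    · intro s hs t _ hst
      have := hAlo i hi s t hs hst
      have := mul_nonneg he0.le (sub_nonneg.2 hst)
      linarith
    · exact (hmono i hi).monotoneOn
  have hreach : ∀ i w, ∃ t, 0 ≤ t ∧ w ≤ A i t := fun i w => by
    rcases lt_or_ge (i : ℕ) m1 with hi | hi
    · refine ⟨max w 0 / e0, by positivity, ?_⟩
      have := hAlo i hi 0 (max w 0 / e0) le_rfl (by positivity)
      rw [hA0, sub_zero, sub_zero, mul_div_cancel₀ _ he0.ne'] at this
      exact (le_max_left _ _).trans this
    · exact ((Filter.eventually_ge_atTop 0).and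
        ((htop i hi).eventually_ge_atTop w)).exists
  have hm : 0 < m := lt_of_lt_of_le hm1 hm1m
  obtain ⟨τ, -, hτ⟩ := Finset.exists_mem_eq_inf' (s := Finset.univ)
    ⟨fun _ => ⟨0, hm⟩, Finset.mem_univ _⟩ (makespan (n := n) hm A p)
  change optMakespan hm A p = makespan hm A p τ at hτ
  change makespan hm A p σ ≤ _ * optMakespan hm A p
  rw [hτ]
  set T := makespan hm A p τ
  have hfT : ∀ i, finish (A i) (load p τ i) ≤ T := fun i =>
    Finset.le_sup' (fun i => finish (A i) (load p τ i)) (Finset.mem_univ i)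
  have hT0 : 0 ≤ T := (finish_nonneg _ _).trans (hfT ⟨0, hm⟩)
  have hloadT : ∀ i, load p τ i ≤ A i T := fun i =>
    (le_apply_finish (hAub i) (hreach i _)).trans
      (hmon i (finish_nonneg _ _) hT0 (hfT i))
  have hpT : ∀ j, p j ≤ T := fun j => by
    have := hAub (τ j) 0 T le_rfl hT0
    rw [hA0] at this
    linarith [le_load hp τ j, hloadT (τ j)]
  have hfactor : T ≤ (1 + (((m - 1) / m1 + 1 : ℕ) : ℝ) / e0) * T :=
    le_mul_of_one_le_left hT0 (le_add_of_nonneg_right (by positivity))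
  refine Finset.sup'_le _ _ fun i _ => ?_
  rcases (Finset.univ.filter (fun j => σ j = i)).eq_empty_or_nonempty with he | hne
  · have : finish (A i) (load p σ i) ≤ 0 := finish_le le_rfl (by simp [load, he, hA0])
    linarith
  obtain ⟨k, rfl, hk⟩ := exists_load_eq_prefLoad_add p σ i hne
  rw [hk]
  have hC := hECT k
  set C := finish (A (σ k)) (prefLoad p σ (σ k) k + p k)
  rcases le_or_gt C T with hCT | hTC
  · exact hCT.trans hfactor
  have hw : ∀ i, 0 ≤ prefLoad p σ i k + p k := fun i =>
    add_nonneg (prefLoad_nonneg hp σ i k) (hp k).le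
  have hmachine : ∀ i : Fin m,
      (if (i : ℕ) < m1 then e0 * (C - T) else 0) ≤ prefLoad p σ i k + p k - A i T := by
    intro i
    split_ifs with hi
    · have h1 := hAlo i hi T C hT0 hTC.le
      have h2 := apply_le_of_le_finish (hA0 i) (hAub i) (hw i) (hT0.trans hTC.le) (hC i)
      linarith
    · have h2 := apply_le_of_le_finish (hA0 i) (hAub i) (hw i) hT0 (hTC.le.trans (hC i))
      linarith
  have hsum := Finset.sum_le_sum fun i (_ : i ∈ Finset.univ) => hmachine i
  have hcard : (Finset.univ.filter (fun i : Fin m => (i : ℕ) < m1)).card = m1 := by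
    rw [Fin.card_filter_val_lt, min_eq_right hm1m]
  rw [← Finset.sum_filter, Finset.sum_const, hcard, nsmul_eq_mul, Finset.sum_sub_distrib,
    Finset.sum_add_distrib, Finset.sum_const, Finset.card_univ, Fintype.card_fin,
    nsmul_eq_mul] at hsum
  have hopt := Finset.sum_le_sum fun i (_ : i ∈ Finset.univ) => hloadT i
  rw [sum_load] at hopt
  have hpref := sum_prefLoad_add_le hp σ k
  have hfloor : (m : ℝ) - 1 ≤ m1 * (((m - 1) / m1 + 1 : ℕ) : ℝ) := by
    have h : m ≤ m1 * ((m - 1) / m1 + 1) + 1 := by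
      have := Nat.lt_mul_div_succ (m - 1) hm1
      omega
    have : (m : ℝ) ≤ m1 * (((m - 1) / m1 + 1 : ℕ) : ℝ) + 1 := by exact_mod_cast h
    linarith
  generalize (((m - 1) / m1 + 1 : ℕ) : ℝ) = q at hfloor ⊢
  have hm' : (0 : ℝ) ≤ m - 1 := sub_nonneg.2 (by exact_mod_cast hm)
  have hmain : m1 * (e0 * (C - T)) ≤ m1 * (q * T) := calc
    m1 * (e0 * (C - T)) ≤ (m - 1) * p k := by linarith
    _ ≤ (m - 1) * T := mul_le_mul_of_nonneg_left (hpT k) hm'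
    _ ≤ m1 * q * T := mul_le_mul_of_nonneg_right hfloor hT0
    _ = m1 * (q * T) := mul_assoc _ _ _
  have hdiff := le_of_mul_le_mul_left hmain (by exact_mod_cast hm1)
  have : C - T ≤ q * T / e0 := (le_div_iff₀' he0).2 hdiff
  calc C ≤ T + q * T / e0 := by linarith
    _ = (1 + q / e0) * T := by ring
end

section
/- Let a : Fin n → ℕ with a_j ≥ 1 for all j, let A = ∑_j a_j be even, and let f > 1 be a real number. Let Ā : ℝ → ℝ be defined by Ā(t) = t for 0 ≤ t ≤ A/2 and Ā(t) = A/2 + (t − A/2)/(n·f·A) for t ≥ A/2, and let g(w) = sInf {t ≥ 0 : Ā(t) ≥ w}. A schedule is a pair of an assignment σ : Fin n → Fin 2 and a linear order ≺ on Fin n, and the completion time of job j is C_j = g(∑_{k : σ k = σ j and k ⪯ j} a_k). Then there exists a schedule with ∑_j C_j ≤ f·n·A/2 if and only if there exists a subset T ⊆ Fin n with ∑_{j ∈ T} a_j = A/2. -/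
theorem stmt_13 (n : ℕ) (a : Fin n → ℕ) (ha : ∀ j, 1 ≤ a j)
    (A : ℕ) (hA : A = ∑ j, a j) (hAeven : Even A)
    (f : ℝ) (hf : 1 < f)
    (Abar : ℝ → ℝ)
    (h1 : ∀ t : ℝ, 0 ≤ t → t ≤ (A : ℝ) / 2 → Abar t = t)
    (h2 : ∀ t : ℝ, (A : ℝ) / 2 ≤ t →
      Abar t = (A : ℝ) / 2 + (t - (A : ℝ) / 2) / ((n : ℝ) * f * A))
    (g : ℝ → ℝ) (hg : ∀ w : ℝ, g w = sInf {t : ℝ | 0 ≤ t ∧ w ≤ Abar t}) :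
    (∃ (σ : Fin n → Fin 2) (π : Equiv.Perm (Fin n)),
        ∑ j, g (∑ k ∈ Finset.univ.filter (fun k => σ k = σ j ∧ π k ≤ π j), (a k : ℝ))
          ≤ f * (n : ℝ) * (A : ℝ) / 2)
      ↔ ∃ T : Finset (Fin n), ∑ j ∈ T, (a j : ℝ) = (A : ℝ) / 2 := by
  obtain ⟨m, hm⟩ := hAeven
  have hhalf : (A : ℝ) / 2 = m := by rw [hm]; push_cast; ring
  have hgnonneg : ∀ w, 0 ≤ g w := fun w => by
    rw [hg]; exact Real.sInf_nonneg fun t ht => ht.1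
  have hf0 : 0 < f := by linarith
  constructor
  · rintro ⟨σ, π, hsum⟩
    have hload : ∀ i : Fin 2, ∑ k ∈ Finset.univ.filter (fun k => σ k = i), a k ≤ m := by
      intro i
      by_contra! hlt
      have hne : (Finset.univ.filter (fun k => σ k = i)).Nonempty := by
        rw [Finset.nonempty_iff_ne_empty]
        intro he
        simp [he] at hlt
      obtain ⟨j, hj, hmax⟩ := Finset.exists_max_image _ π hne
      have hσj : σ j = i := (Finset.mem_filter.mp hj).2
      have hprefix : Finset.univ.filter (fun k => σ k = σ j ∧ π k ≤ π j) =
          Finset.univ.filter (fun k => σ k = i) := by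
        ext k
        simp only [Finset.mem_filter, Finset.mem_univ, true_and, hσj]
        exact ⟨fun h => h.1, fun h => ⟨h, hmax k (by simp [h])⟩⟩
      have hnpos : (0 : ℝ) < n := by exact_mod_cast j.pos
      have hApos : (0 : ℝ) < A := by
        have h := Finset.single_le_sum (f := a) (fun k _ => Nat.zero_le _) (Finset.mem_univ j)
        have := ha j
        exact_mod_cast (by omega : 0 < A)
      have hD : 0 < (n : ℝ) * f * A := by positivity
      set L : ℝ := ∑ k ∈ Finset.univ.filter (fun k => σ k = σ j ∧ π k ≤ π j), (a k : ℝ) with hL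
      have hLge : (A : ℝ) / 2 + 1 ≤ L := by
        rw [hhalf, hL, hprefix]
        exact_mod_cast hlt
      have hgL : (A : ℝ) / 2 + n * f * A ≤ g L := by
        rw [hg]
        apply le_csInf
        · refine ⟨A / 2 + L * (n * f * A), by nlinarith, ?_⟩
          rw [h2 _ (by nlinarith), add_sub_cancel_left, mul_div_cancel_right₀ _ hD.ne']
          linarith
        · rintro t ⟨ht0, htL⟩
          rcases le_total t ((A : ℝ) / 2) with h | h
          · rw [h1 t ht0 h] at htL
            linarith
          · rw [h2 t h] at htL
            have h3 : 1 ≤ (t - (A : ℝ) / 2) / ((n : ℝ) * f * A) := by linarith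
            rw [le_div_iff₀ hD] at h3
            linarith
      have hle := Finset.single_le_sum
        (f := fun j => g (∑ k ∈ Finset.univ.filter (fun k => σ k = σ j ∧ π k ≤ π j), (a k : ℝ)))
        (fun k _ => hgnonneg _) (Finset.mem_univ j)
      have hle' : g L ≤ f * (n : ℝ) * (A : ℝ) / 2 := le_trans hle hsum
      nlinarith
    refine ⟨Finset.univ.filter (fun k => σ k = 0), ?_⟩
    have htotal : ∑ k ∈ Finset.univ.filter (fun k => σ k = 0), a k +
        ∑ k ∈ Finset.univ.filter (fun k => σ k = 1), a k = A := by
      have h := Finset.sum_fiberwise Finset.univ σ a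
      rwa [Fin.sum_univ_two, ← hA] at h
    have h0 := hload 0
    have h1' := hload 1
    rw [hhalf]
    exact_mod_cast (by omega : ∑ k ∈ Finset.univ.filter (fun k => σ k = 0), a k = m)
  · rintro ⟨T, hT⟩
    refine ⟨fun k => if k ∈ T then 0 else 1, Equiv.refl _, ?_⟩
    have hTc : ∑ j ∈ Tᶜ, (a j : ℝ) = (A : ℝ) / 2 := by
      have h := Finset.sum_add_sum_compl T (fun j => (a j : ℝ))
      have hA' : (A : ℝ) = ∑ j, (a j : ℝ) := by rw [hA]; push_cast; rfl
      linarith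
    have hgle : ∀ w : ℝ, w ≤ (A : ℝ) / 2 → g w ≤ (A : ℝ) / 2 := by
      intro w hw
      rw [hg]
      exact csInf_le ⟨0, fun t ht => ht.1⟩
        ⟨by positivity, by rwa [h1 _ (by positivity) le_rfl]⟩
    calc _ ≤ ∑ _j : Fin n, (A : ℝ) / 2 := by
          refine Finset.sum_le_sum fun j _ => hgle _ ?_
          by_cases hj : j ∈ T
          · rw [← hT]
            refine Finset.sum_le_sum_of_subset_of_nonneg ?_ fun _ _ _ => Nat.cast_nonneg _
            intro k hk
            by_contra hkT
            simp [hj, hkT] at hk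
          · rw [← hTc]
            refine Finset.sum_le_sum_of_subset_of_nonneg ?_ fun _ _ _ => Nat.cast_nonneg _
            intro k hk
            by_contra hkT
            rw [Finset.mem_compl, not_not] at hkT
            simp [hj, hkT] at hk
      _ = (n : ℝ) * (A : ℝ) / 2 := by simp; ring
      _ ≤ f * (n : ℝ) * (A : ℝ) / 2 := by
          have : (0 : ℝ) ≤ (n : ℝ) * A := by positivity
          nlinarith
end

section
/- Let p : ℕ → ℝ be nonnegative and nondecreasing, let m_1 ≥ 1 and c ≥ 1 be integers, and set m = c·m_1. Then for all integers λ ≥ 0 and j with j ≥ λ·m_1: ∑_{t=0}^{λ} p(j − t·m_1) ≤ c · ∑_{s=0}^{⌊λ/c⌋} p(j − s·m). -/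
theorem sum_range_mul_div (f : ℕ → ℝ) {c : ℕ} (hc : 0 < c) (n : ℕ) :
    ∑ t ∈ Finset.range (c * n), f (t / c) = (c : ℝ) * ∑ s ∈ Finset.range n, f s := by
  induction n with
  | zero => simp
  | succ n ih =>
    have h : ∑ t ∈ Finset.range c, f ((c * n + t) / c) = ∑ _t ∈ Finset.range c, f n := by
      refine Finset.sum_congr rfl fun t ht => ?_
      rw [Nat.mul_add_div hc, Nat.div_eq_of_lt (Finset.mem_range.mp ht), add_zero]
    rw [Nat.mul_succ, Finset.sum_range_add, ih, h, Finset.sum_range_succ]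
    simp [mul_add]

theorem stmt_14 (p : ℕ → ℝ) (hp0 : ∀ k, 0 ≤ p k) (hmono : Monotone p)
    (m1 c : ℕ) (hm1 : 1 ≤ m1) (hc : 1 ≤ c) (m : ℕ) (hm : m = c * m1) :
    ∀ lam j : ℕ, lam * m1 ≤ j →
      ∑ t ∈ Finset.range (lam + 1), p (j - t * m1)
        ≤ (c : ℝ) * ∑ s ∈ Finset.range (lam / c + 1), p (j - s * m) := by
  intro lam j _
  subst hm
  rw [← sum_range_mul_div (fun s => p (j - s * (c * m1))) hc]
  calc ∑ t ∈ Finset.range (lam + 1), p (j - t * m1)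
      ≤ ∑ t ∈ Finset.range (lam + 1), p (j - t / c * (c * m1)) := by
        refine Finset.sum_le_sum fun t _ => hmono (Nat.sub_le_sub_left ?_ j)
        rw [← mul_assoc]
        exact Nat.mul_le_mul_right m1 (Nat.div_mul_le_self t c)
    _ ≤ ∑ t ∈ Finset.range (c * (lam / c + 1)), p (j - t / c * (c * m1)) := by
        refine Finset.sum_le_sum_of_subset_of_nonneg ?_ fun _ _ _ => hp0 _
        exact Finset.range_subset_range.mpr (Nat.lt_mul_div_succ lam hc)
end

section
/- Let p : Fin n → ℝ with p_j > 0 for all j. For an integer m ≥ 1, a schedule on m full-capacity identical machines is a pair of an assignment σ : Fin n → Fin m and a linear order ≺ on Fin n, and the completion time of job j is C_j = ∑_{k : σ k = σ j and k ⪯ j} p_k; let OPT_m(p) denote the minimum over all such schedules of ∑_j C_j. Then for all integers 1 ≤ m_1 ≤ m: OPT_{m_1}(p) ≤ ⌈m/m_1⌉ · OPT_m(p). -/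
/-- The minimum total completion time of jobs with processing times `p` on `m`
full-capacity identical machines, over all schedules (an assignment of jobs to
machines together with a linear processing order on the jobs, here given by a
permutation recording the positions of the jobs in the order). -/
noncomputable def optTC (m n : ℕ) (hm : 0 < m) (p : Fin n → ℝ) : ℝ :=
  Finset.univ.inf'
    ⟨(fun _ => ⟨0, hm⟩, Equiv.refl (Fin n)), Finset.mem_univ _⟩
    (fun sp : (Fin n → Fin m) × Equiv.Perm (Fin n) =>
      ∑ j, ∑ k ∈ Finset.univ.filter (fun k => sp.1 k = sp.1 j ∧ sp.2 k ≤ sp.2 j), p k)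

/-- The completion time of job `j` when the assignment is `σ` and the positions are `π`. -/
noncomputable def completionTime {m n : ℕ} (p : Fin n → ℝ) (σ : Fin n → Fin m)
    (π : Equiv.Perm (Fin n)) (j : Fin n) : ℝ :=
  ∑ k ∈ Finset.univ.filter (fun k => σ k = σ j ∧ π k ≤ π j), p k

lemma completionTime_nonneg {m n : ℕ} {p : Fin n → ℝ} (hp : ∀ j, 0 ≤ p j) (σ : Fin n → Fin m)
    (π : Equiv.Perm (Fin n)) (j : Fin n) : 0 ≤ completionTime p σ π j :=
  Finset.sum_nonneg fun k _ => hp k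

/-- The work a single machine has finished by time `t` is at most `t`. -/
lemma sum_completed_le {m n : ℕ} {p : Fin n → ℝ} (hp : ∀ j, 0 ≤ p j) (σ : Fin n → Fin m)
    (π : Equiv.Perm (Fin n)) (i : Fin m) {t : ℝ} (ht : 0 ≤ t) :
    ∑ k ∈ Finset.univ.filter (fun k => σ k = i ∧ completionTime p σ π k ≤ t), p k ≤ t := by
  rcases (Finset.univ.filter
    (fun k => σ k = i ∧ completionTime p σ π k ≤ t)).eq_empty_or_nonempty with h | h
  · simpa [h] using ht
  · obtain ⟨l, hl, hmax⟩ := Finset.exists_max_image _ π h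
    simp only [Finset.mem_filter, Finset.mem_univ, true_and] at hl hmax
    refine le_trans (Finset.sum_le_sum_of_subset_of_nonneg ?_ fun k _ _ => hp k) hl.2
    intro k hk
    simp only [Finset.mem_filter, Finset.mem_univ, true_and] at hk ⊢
    exact ⟨hk.1.trans hl.1.symm, hmax k hk⟩

/-- A residue class modulo `d` contains at most `⌈m / d⌉` elements of `Fin m`. -/
lemma card_filter_mod_le_ceil {m d : ℕ} (hd : 0 < d) (r : ℕ) :
    ((Finset.univ.filter (fun i : Fin m => (i : ℕ) % d = r)).card : ℝ)
      ≤ (⌈(m : ℝ) / (d : ℝ)⌉ : ℝ) := by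
  have hd' : (0 : ℝ) < d := by exact_mod_cast hd
  have hcard : (Finset.univ.filter (fun i : Fin m => (i : ℕ) % d = r)).card
      ≤ (Finset.range ⌈(m : ℝ) / (d : ℝ)⌉₊).card := by
    refine Finset.card_le_card_of_injOn (fun i => (i : ℕ) / d) ?_ ?_
    · intro i _
      simp only [Finset.coe_range, Set.mem_Iio]
      rw [Nat.lt_ceil]
      refine lt_of_le_of_lt Nat.cast_div_le ?_
      gcongr
      exact i.isLt
    · intro i hi j hj hij
      simp only [Finset.coe_filter, Finset.mem_univ, true_and, Set.mem_ofPred_eq] at hi hj hij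
      ext
      rw [← Nat.div_add_mod (i : ℕ) d, ← Nat.div_add_mod (j : ℕ) d, hij, hi, hj]
  rw [Finset.card_range] at hcard
  rw [← natCast_ceil_eq_intCast_ceil (by positivity)]
  exact_mod_cast hcard

/-- Merging the machines in each residue class modulo `d`, and processing the jobs in the order
of their original completion times, delays each job by a factor of at most `⌈m / d⌉`. -/
lemma completionTime_merge_le {m n d : ℕ} (hd : 0 < d) {p : Fin n → ℝ} (hp : ∀ j, 0 ≤ p j)
    (σ : Fin n → Fin m) (π : Equiv.Perm (Fin n)) (j : Fin n) :
    completionTime p (fun k => (⟨σ k % d, Nat.mod_lt _ hd⟩ : Fin d))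
        (Tuple.sort (completionTime p σ π)).symm j
      ≤ (⌈(m : ℝ) / (d : ℝ)⌉ : ℝ) * completionTime p σ π j := by
  set C := completionTime p σ π with hC
  have hCj : 0 ≤ C j := completionTime_nonneg hp σ π j
  have hsort (k : Fin n) (h : (Tuple.sort C).symm k ≤ (Tuple.sort C).symm j) : C k ≤ C j := by
    simpa using Tuple.monotone_sort C h
  set I := Finset.univ.filter (fun i : Fin m => (i : ℕ) % d = σ j % d)
  calc
    _ ≤ ∑ k ∈ Finset.univ.filter (fun k => σ k ∈ I ∧ C k ≤ C j), p k := by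
      refine Finset.sum_le_sum_of_subset_of_nonneg ?_ fun k _ _ => hp k
      intro k hk
      simp only [Finset.mem_filter, Finset.mem_univ, true_and, Fin.mk.injEq, I] at hk ⊢
      exact ⟨hk.1, hsort k hk.2⟩
    _ = ∑ i ∈ I, ∑ k ∈ Finset.univ.filter (fun k => σ k = i ∧ C k ≤ C j), p k := by
      rw [← Finset.sum_fiberwise_of_maps_to (t := I) (g := σ)
        (fun k hk => (Finset.mem_filter.1 hk).2.1)]
      refine Finset.sum_congr rfl fun i hi => Finset.sum_congr ?_ fun _ _ => rfl
      ext k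
      simp only [Finset.mem_filter, Finset.mem_univ, true_and]
      constructor
      · rintro ⟨⟨_, h⟩, rfl⟩
        exact ⟨rfl, h⟩
      · rintro ⟨rfl, h⟩
        exact ⟨⟨hi, h⟩, rfl⟩
    _ ≤ ∑ _i ∈ I, C j := Finset.sum_le_sum fun i _ => sum_completed_le hp σ π i hCj
    _ = (I.card : ℝ) * C j := by rw [Finset.sum_const, nsmul_eq_mul]
    _ ≤ _ := mul_le_mul_of_nonneg_right (card_filter_mod_le_ceil hd _) hCj

theorem stmt_15 (n : ℕ) (p : Fin n → ℝ) (hp : ∀ j, 0 < p j)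
    (m1 m : ℕ) (hm1 : 1 ≤ m1) (hm1m : m1 ≤ m) :
    optTC m1 n hm1 p ≤ (⌈(m : ℝ) / (m1 : ℝ)⌉ : ℝ) * optTC m n (lt_of_lt_of_le hm1 hm1m) p := by
  have hm : 0 < m := lt_of_lt_of_le hm1 hm1m
  obtain ⟨⟨σ, π⟩, -, hopt⟩ := Finset.exists_mem_eq_inf'
    (s := (Finset.univ : Finset ((Fin n → Fin m) × Equiv.Perm (Fin n))))
    ⟨(fun _ => ⟨0, hm⟩, Equiv.refl (Fin n)), Finset.mem_univ _⟩
    (fun sp => ∑ j, completionTime p sp.1 sp.2 j)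
  have hopt' : optTC m n hm p = ∑ j, completionTime p σ π j := hopt
  rw [hopt', Finset.mul_sum]
  refine le_trans (Finset.inf'_le _ (Finset.mem_univ
    ((fun k => (⟨σ k % m1, Nat.mod_lt _ hm1⟩ : Fin m1)),
      (Tuple.sort (completionTime p σ π)).symm))) ?_
  exact Finset.sum_le_sum fun j _ => completionTime_merge_le hm1 (fun k => (hp k).le) σ π j
end

section
/- Let 0 < e_0 ≤ 1, 1 ≤ m_1 ≤ m, with machines modeled as follows: for i < m_1, A_i : ℝ → ℝ with A_i(0) = 0 and e_0·(t − s) ≤ A_i(t) − A_i(s) ≤ t − s for all 0 ≤ s ≤ t; for the remaining i, A_i with A_i(0) = 0, A_i(t) − A_i(s) ≤ t − s for 0 ≤ s ≤ t, strictly increasing and unbounded; g_i(w) = sInf {t ≥ 0 : A_i(t) ≥ w}. Let p : Fin n → ℝ with 0 < p_1 ≤ p_2 ≤ … ≤ p_n (SPT order), and let σ : Fin n → Fin m be an ECT schedule for the order 1, …, n: for every job k and every machine i, g_{σ k}(L_{σ k}^{<k}(σ) + p_k) ≤ g_i(L_i^{<k}(σ) + p_k), where L_i^{<k}(σ) = ∑_{j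 < k, σ j = i} p_j; the completion time of job k is C_k(σ) = g_{σ k}(L_{σ k}^{<k}(σ) + p_k). Let OPT be the minimum of ∑_j C_j over all schedules, where a schedule is an assignment τ : Fin n → Fin m together with a linear order ≺ on Fin n and C_j = g_{τ j}(∑_{k : τ k = τ j, k ⪯ j} p_k). Then ∑_k C_k(σ) ≤ (⌈m/m_1⌉/e_0) · OPT. -/
section FinishTime

variable {A : ℝ → ℝ}

theorem finish_le_of_le {w t : ℝ} (ht : 0 ≤ t) (h : w ≤ A t) : finish A w ≤ t :=
  csInf_le ⟨0, fun _ hx => hx.1⟩ ⟨ht, h⟩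

theorem finish_zero (h0 : A 0 = 0) : finish A 0 = 0 :=
  le_antisymm (finish_le_of_le le_rfl h0.ge) (Real.sInf_nonneg fun _ hx => hx.1)

theorem le_finish_s16 (h0 : A 0 = 0) (hub : ∀ s t : ℝ, 0 ≤ s → s ≤ t → A t - A s ≤ t - s) {w : ℝ}
    (hne : ∃ t, 0 ≤ t ∧ w ≤ A t) : w ≤ finish A w := by
  refine le_csInf hne fun t ht => ?_
  have := hub 0 t le_rfl ht.1
  linarith [ht.2]

theorem exists_le_of_growth {e : ℝ} (he : 0 < e) (h0 : A 0 = 0)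
    (hlo : ∀ s t : ℝ, 0 ≤ s → s ≤ t → e * (t - s) ≤ A t - A s) (w : ℝ) :
    ∃ t, 0 ≤ t ∧ w ≤ A t := by
  have ht : 0 ≤ |w| / e := by positivity
  refine ⟨|w| / e, ht, ?_⟩
  have := hlo 0 _ le_rfl ht
  rw [h0, sub_zero, sub_zero, mul_div_cancel₀ _ he.ne'] at this
  exact (le_abs_self w).trans this

theorem finish_add_le {e : ℝ} (he : 0 < e) (h0 : A 0 = 0)
    (hlo : ∀ s t : ℝ, 0 ≤ s → s ≤ t → e * (t - s) ≤ A t - A s) (w : ℝ) {x : ℝ} (hx : 0 ≤ x) :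
    finish A (w + x) ≤ finish A w + x / e := by
  rw [← sub_le_iff_le_add]
  refine le_csInf (exists_le_of_growth he h0 hlo w) fun t ht => ?_
  have hxe : 0 ≤ x / e := by positivity
  rw [sub_le_iff_le_add]
  refine finish_le_of_le (add_nonneg ht.1 hxe) ?_
  have := hlo t (t + x / e) ht.1 (by linarith)
  rw [add_sub_cancel_left, mul_div_cancel₀ _ he.ne'] at this
  linarith [ht.2]

end FinishTime

section Rearrangement

theorem sum_range_card_le_sum {f : ℕ → ℝ} (hf : Monotone f) (s : Finset ℕ) :
    ∑ r ∈ Finset.range s.card, f r ≤ ∑ r ∈ s, f r := by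
  induction s using Finset.induction_on_max with
  | empty => simp
  | insert a s hs ih =>
    have ha : a ∉ s := fun h => lt_irrefl _ (hs a h)
    rw [Finset.card_insert_of_notMem ha, Finset.sum_range_succ, Finset.sum_insert ha, add_comm]
    have hcard : s.card ≤ a := by
      simpa using Finset.card_le_card
        (show s ⊆ Finset.range a from fun x hx => Finset.mem_range.2 (hs x hx))
    exact add_le_add (hf hcard) ih

theorem sum_mul_rev_le_sum_mul {f : ℕ → ℝ} (hf : Monotone f) {n : ℕ} {p : Fin n → ℝ}
    (hp : ∀ j, 0 ≤ p j) (hmono : Monotone p) {h : Fin n → ℕ} (hh : Function.Injective h) :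
    ∑ k, p k * f (n - 1 - k) ≤ ∑ k, p k * f (h k) := by
  induction n with
  | zero => simp
  | succ n ih =>
    have key := ih (p := fun k => p k.succ - p 0) (fun j => sub_nonneg.2 (hmono (Fin.zero_le _)))
      (fun a b hab => sub_le_sub_right (hmono (Fin.succ_le_succ_iff.2 hab)) _)
      (hh.comp (Fin.succ_injective n))
    have base : ∑ k : Fin (n + 1), f (n - k) ≤ ∑ k, f (h k) := by
      have := sum_range_card_le_sum hf (Finset.univ.map ⟨h, hh⟩)
      rw [Finset.card_map, Finset.card_univ, Fintype.card_fin, Finset.sum_map] at this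
      rw [← Finset.sum_range_reflect, Finset.sum_range] at this
      simpa using this
    have split : ∀ g : Fin (n + 1) → ℝ, ∑ k, p k * g k
        = p 0 * ∑ k, g k + ∑ k : Fin n, (p k.succ - p 0) * g k.succ := by
      intro g
      rw [Fin.sum_univ_succ, Fin.sum_univ_succ g, mul_add, Finset.mul_sum, add_assoc,
        ← Finset.sum_add_distrib]
      congr 1
      exact Finset.sum_congr rfl fun k _ => by ring
    rw [split, split]
    refine add_le_add (mul_le_mul_of_nonneg_left (by simpa using base) (hp 0)) ?_
    refine le_trans (le_of_eq (Finset.sum_congr rfl fun k _ => ?_)) key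
    simp only [Fin.val_succ]
    congr 2
    omega

end Rearrangement

section Slots

variable {n m : ℕ} (τ : Fin n → Fin m) (π : Equiv.Perm (Fin n))

/-- The number of jobs that follow `k` on its machine. -/
def jobsAfter (k : Fin n) : ℕ :=
  (Finset.univ.filter fun j => τ j = τ k ∧ π k < π j).card

theorem jobsAfter_lt {j k : Fin n} (hτ : τ j = τ k) (h : π j < π k) :
    jobsAfter τ π k < jobsAfter τ π j := by
  refine Finset.card_lt_card (Finset.ssubset_iff_of_subset ?_ |>.2 ⟨k, ?_, ?_⟩)
  · intro x
    simp only [Finset.mem_filter, Finset.mem_univ, true_and, hτ]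
    exact fun hx => ⟨hx.1, h.trans hx.2⟩
  · simp [hτ, h]
  · simp

theorem slot_injective : Function.Injective fun k => jobsAfter τ π k * m + τ k := by
  intro j k h
  have hm : 0 < m := (τ j).pos
  have hτ : τ j = τ k := by
    have := congrArg (· % m) h
    simpa [Nat.mod_eq_of_lt, Fin.ext_iff] using this
  have hd : jobsAfter τ π j = jobsAfter τ π k := by
    simpa [hτ, hm.ne'] using h
  rcases lt_trichotomy (π j) (π k) with hlt | heq | hgt
  · exact absurd hd (jobsAfter_lt τ π hτ hlt).ne'
  · exact π.injective heq
  · exact absurd hd (jobsAfter_lt τ π hτ.symm hgt).ne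

theorem sum_sum_eq_sum_mul_jobsAfter (p : Fin n → ℝ) :
    ∑ j, ∑ k ∈ Finset.univ.filter (fun k => τ k = τ j ∧ π k ≤ π j), p k
      = ∑ k, p k * ((jobsAfter τ π k : ℝ) + 1) := by
  simp only [Finset.sum_filter]
  rw [Finset.sum_comm]
  refine Finset.sum_congr rfl fun k _ => ?_
  rw [← Finset.sum_filter, Finset.sum_const, nsmul_eq_mul, mul_comm]
  congr 1
  have : (Finset.univ.filter fun j => τ k = τ j ∧ π k ≤ π j)
      = insert k (Finset.univ.filter fun j => τ j = τ k ∧ π k < π j) := by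
    ext j
    simp only [Finset.mem_filter, Finset.mem_univ, true_and, Finset.mem_insert]
    rw [le_iff_eq_or_lt, π.injective.eq_iff]
    constructor
    · rintro ⟨h, h' | h'⟩
      exacts [Or.inl h'.symm, Or.inr ⟨h.symm, h'⟩]
    · rintro (rfl | ⟨h, h'⟩)
      exacts [⟨rfl, Or.inl rfl⟩, ⟨h.symm, Or.inr h'⟩]
  rw [this, Finset.card_insert_of_notMem (by simp), jobsAfter]
  push_cast
  rfl

theorem sum_mul_le_sum_completion {p : Fin n → ℝ} (hp : ∀ j, 0 ≤ p j) (hmono : Monotone p) :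
    ∑ k : Fin n, p k * (((n - 1 - k) / m : ℕ) + 1 : ℝ)
      ≤ ∑ j, ∑ k ∈ Finset.univ.filter (fun k => τ k = τ j ∧ π k ≤ π j), p k := by
  have hf : Monotone fun r : ℕ => ((r / m : ℕ) + 1 : ℝ) := fun a b hab => by
    have := Nat.div_le_div_right (c := m) hab
    simpa using this
  refine (sum_mul_rev_le_sum_mul hf hp hmono (slot_injective τ π)).trans (le_of_eq ?_)
  rw [sum_sum_eq_sum_mul_jobsAfter]
  refine Finset.sum_congr rfl fun k _ => ?_
  have hm : 0 < m := (τ k).pos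
  have : (jobsAfter τ π k * m + τ k) / m = jobsAfter τ π k := by
    rw [mul_comm, Nat.mul_add_div hm, Nat.div_eq_of_lt (τ k).isLt, add_zero]
  simp only [this]

end Slots

section RoundRobin

/-- The completion time of job `k` when jobs `0, 1, …` are dealt cyclically to `q` machines of
unit speed. -/
def roundRobin (P : ℕ → ℝ) (q k : ℕ) : ℝ :=
  ∑ a ∈ Finset.range (k / q + 1), P (k - a * q)

theorem roundRobin_of_le (P : ℕ → ℝ) {q k : ℕ} (hq : 0 < q) (h : q ≤ k) :
    roundRobin P q k = roundRobin P q (k - q) + P k := by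
  rw [roundRobin, roundRobin, Finset.sum_range_succ', Nat.div_eq_sub_div hq h]
  congr 1
  · refine Finset.sum_congr rfl fun a _ => ?_
    rw [Nat.sub_sub, add_mul, one_mul, add_comm]
  · simp

theorem le_roundRobin {P : ℕ → ℝ} (hP : ∀ j, 0 ≤ P j) (q k : ℕ) : P k ≤ roundRobin P q k := by
  rw [roundRobin, Finset.sum_range_succ']
  simpa using Finset.sum_nonneg fun a _ => hP _

theorem roundRobin_le_roundRobin {P : ℕ → ℝ} (hP : ∀ j, 0 ≤ P j) {n : ℕ}
    (hmono : ∀ j k, j ≤ k → k < n → P j ≤ P k) (q : ℕ) {j k : ℕ} (hjk : j ≤ k) (hk : k < n) :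
    roundRobin P q j ≤ roundRobin P q k := by
  refine (Finset.sum_le_sum fun a _ => hmono (j - a * q) (k - a * q) (by omega) (by omega)).trans ?_
  refine Finset.sum_le_sum_of_subset_of_nonneg ?_ fun _ _ _ => hP _
  have := Nat.div_le_div_right (c := q) hjk
  exact Finset.range_subset_range.2 (by omega)

theorem sum_roundRobin_le {P : ℕ → ℝ} (hP : ∀ j, 0 ≤ P j) {q : ℕ} (hq : 0 < q) (n : ℕ) :
    ∑ k ∈ Finset.range n, roundRobin P q k
      ≤ ∑ j ∈ Finset.range n, P j * (((n - 1 - j) / q : ℕ) + 1 : ℝ) := by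
  simp only [roundRobin]
  rw [Finset.sum_sigma', ← Finset.sum_fiberwise_of_maps_to (t := Finset.range n)
    (g := fun x : (_ : ℕ) × ℕ => x.1 - x.2 * q)]
  · refine Finset.sum_le_sum fun j _ => ?_
    rw [Finset.sum_congr rfl (g := fun _ => P j) fun x hx => by rw [(Finset.mem_filter.1 hx).2],
      Finset.sum_const, nsmul_eq_mul, mul_comm]
    refine mul_le_mul_of_nonneg_left ?_ (hP j)
    have hle : ∀ x : (_ : ℕ) × ℕ, x.2 < x.1 / q + 1 → x.2 * q ≤ x.1 := fun x hx =>
      (Nat.le_div_iff_mul_le hq).1 (Nat.lt_succ_iff.1 hx)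
    have hcard := Finset.card_le_card_of_injOn
      (s := {x ∈ (Finset.range n).sigma fun k => Finset.range (k / q + 1) | x.1 - x.2 * q = j})
      (t := Finset.range ((n - 1 - j) / q + 1)) (fun x => x.2) ?_ ?_
    · rw [Finset.card_range] at hcard
      exact_mod_cast hcard
    · intro x hx
      simp only [Finset.coe_filter, Finset.mem_sigma, Finset.mem_range, Set.mem_ofPred_eq] at hx
      have := hle x hx.1.2
      simp only [Finset.coe_range, Set.mem_Iio, Nat.lt_succ_iff]
      rw [Nat.le_div_iff_mul_le hq]
      omega
    · intro x hx y hy hxy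
      simp only [Finset.coe_filter, Finset.mem_sigma, Finset.mem_range, Set.mem_ofPred_eq] at hx hy
      have h1 := hle x hx.1.2
      have h2 := hle y hy.1.2
      obtain ⟨x1, x2⟩ := x
      obtain ⟨y1, y2⟩ := y
      simp only at hxy h1 h2 hx hy
      subst hxy
      have : x1 = y1 := by omega
      rw [this]
  · intro x hx
    simp only [Finset.mem_sigma, Finset.mem_range] at hx ⊢
    omega

end RoundRobin

theorem Nat.div_add_one_le_mul_div_add_one {a b c : ℕ} (ha : 0 < a) (hb : 0 < b)
    (h : b ≤ c * a) (r : ℕ) : r / a + 1 ≤ c * (r / b + 1) := by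
  rw [Nat.add_one_le_iff, Nat.div_lt_iff_lt_mul ha]
  calc r < b * (r / b + 1) := Nat.lt_mul_div_succ r hb
    _ ≤ c * a * (r / b + 1) := Nat.mul_le_mul_right _ h
    _ = c * (r / b + 1) * a := by ring

/-- The load before `k` of a machine is zero, or it is the load up to its last job. -/
theorem prefLoad_eq_zero_or_exists {n m : ℕ} (p : Fin n → ℝ) (σ : Fin n → Fin m) (i : Fin m)
    (k : Fin n) : prefLoad p σ i k = 0 ∨
      ∃ j < k, σ j = i ∧ prefLoad p σ i k = prefLoad p σ i j + p j := by
  rcases (Finset.univ.filter fun j => j < k ∧ σ j = i).eq_empty_or_nonempty with he | hne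
  · left
    rw [prefLoad, he, Finset.sum_empty]
  · right
    obtain ⟨j, hj, hmax⟩ := Finset.exists_max_image _ id hne
    simp only [Finset.mem_filter, Finset.mem_univ, true_and, id] at hj hmax
    refine ⟨j, hj.1, hj.2, ?_⟩
    have : (Finset.univ.filter fun l => l < k ∧ σ l = i)
        = insert j (Finset.univ.filter fun l => l < j ∧ σ l = i) := by
      ext l
      simp only [Finset.mem_filter, Finset.mem_univ, true_and, Finset.mem_insert]
      constructor
      · intro hl
        exact (hmax l hl).eq_or_lt.imp id fun h => ⟨h, hl.2⟩
      · rintro (rfl | hl)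
        exacts [hj, ⟨hl.1.trans hj.1, hl.2⟩]
    rw [prefLoad, this, Finset.sum_insert (by simp), add_comm, prefLoad]

/-- Some machine among the first `q` receives none of the `q - 1` jobs preceding `k`. -/
theorem exists_machine_idle {n m q : ℕ} (hq : 0 < q) (hqm : q ≤ m) (σ : Fin n → Fin m)
    (k : Fin n) : ∃ i : Fin m, (i : ℕ) < q ∧ ∀ j < k, σ j = i → (j : ℕ) + q ≤ k := by
  let s : Finset (Fin n) := Finset.univ.filter fun j => j < k ∧ (k : ℕ) < j + q
  have hs : s.card ≤ q - 1 := by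
    have := Finset.card_le_card_of_injOn (s := s) (t := Finset.range (q - 1))
      (fun j => (k : ℕ) - 1 - j) ?_ ?_
    · simpa using this
    · intro j hj
      simp only [s, Finset.coe_filter, Finset.mem_univ, true_and, Set.mem_ofPred_eq,
        Fin.lt_def] at hj
      simp only [Finset.coe_range, Set.mem_Iio]
      omega
    · intro j hj l hl h
      simp only [s, Finset.coe_filter, Finset.mem_univ, true_and, Set.mem_ofPred_eq,
        Fin.lt_def] at hj hl h
      ext
      omega
  obtain ⟨i, hi, hi'⟩ := Finset.exists_mem_notMem_of_card_lt_card
    (s := s.image σ) (t := Finset.univ.map (Fin.castLEEmb hqm))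
    (lt_of_le_of_lt Finset.card_image_le (by simp; omega))
  simp only [Finset.mem_map, Finset.mem_univ, true_and] at hi
  obtain ⟨i, rfl⟩ := hi
  refine ⟨Fin.castLEEmb hqm i, by simp, fun j hj hji => ?_⟩
  by_contra hlt
  exact hi' (Finset.mem_image.2 ⟨j, by simp [s, hj]; omega, hji⟩)

theorem finish_ect_le_roundRobin {n m q : ℕ} (hq : 0 < q) (hqm : q ≤ m) {e : ℝ} (he : 0 < e)
    {A : Fin m → ℝ → ℝ} (hA0 : ∀ i, A i 0 = 0)
    (hlo : ∀ i : Fin m, (i : ℕ) < q → ∀ s t : ℝ, 0 ≤ s → s ≤ t → e * (t - s) ≤ A i t - A i s)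
    {P : ℕ → ℝ} (hP : ∀ j, 0 ≤ P j) (hmono : ∀ j k, j ≤ k → k < n → P j ≤ P k)
    {p : Fin n → ℝ} (hpP : ∀ j, p j = P j) {σ : Fin n → Fin m}
    (hECT : ∀ k : Fin n, ∀ i : Fin m,
      finish (A (σ k)) (prefLoad p σ (σ k) k + p k) ≤ finish (A i) (prefLoad p σ i k + p k))
    (k : Fin n) :
    finish (A (σ k)) (prefLoad p σ (σ k) k + p k) ≤ roundRobin P q k / e := by
  induction k using WellFoundedLT.induction with
  | ind k ih =>
  obtain ⟨i, hi, hidle⟩ := exists_machine_idle hq hqm σ k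
  refine (hECT k i).trans ((finish_add_le he (hA0 i) (hlo i hi) _ (hpP k ▸ hP k)).trans ?_)
  rcases prefLoad_eq_zero_or_exists p σ i k with h0 | ⟨j, hjk, hji, hload⟩
  · rw [h0, finish_zero (hA0 i), zero_add, hpP]
    gcongr
    exact le_roundRobin hP q k
  · have hj := hidle j hjk hji
    have hle := ih j hjk
    rw [hji, ← hload] at hle
    rw [roundRobin_of_le P hq (by omega : q ≤ (k : ℕ)), add_div, hpP k]
    refine add_le_add (hle.trans ?_) le_rfl
    gcongr
    exact roundRobin_le_roundRobin hP hmono q (by omega) (by omega)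

theorem stmt_16 (e0 : ℝ) (he0 : 0 < e0) (he0' : e0 ≤ 1)
    (m m1 n : ℕ) (hm1 : 1 ≤ m1) (hm1m : m1 ≤ m)
    (A : Fin m → ℝ → ℝ) (hA0 : ∀ i, A i 0 = 0)
    (hAub : ∀ i, ∀ s t : ℝ, 0 ≤ s → s ≤ t → A i t - A i s ≤ t - s)
    (hAlo : ∀ i : Fin m, (i : ℕ) < m1 →
      ∀ s t : ℝ, 0 ≤ s → s ≤ t → e0 * (t - s) ≤ A i t - A i s)
    (hmono : ∀ i : Fin m, m1 ≤ (i : ℕ) → StrictMonoOn (A i) (Set.Ici (0 : ℝ)))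
    (htop : ∀ i : Fin m, m1 ≤ (i : ℕ) → Filter.Tendsto (A i) Filter.atTop Filter.atTop)
    (p : Fin n → ℝ) (hp : ∀ j, 0 < p j)
    (hSPT : ∀ j k : Fin n, j ≤ k → p j ≤ p k)
    (σ : Fin n → Fin m)
    (hECT : ∀ k : Fin n, ∀ i : Fin m,
      finish (A (σ k)) (prefLoad p σ (σ k) k + p k) ≤ finish (A i) (prefLoad p σ i k + p k)) :
    ∑ k, finish (A (σ k)) (prefLoad p σ (σ k) k + p k)
      ≤ ((⌈(m : ℝ) / (m1 : ℝ)⌉ : ℝ) / e0) *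
          Finset.univ.inf'
            ⟨(fun _ => ⟨0, lt_of_lt_of_le hm1 hm1m⟩, Equiv.refl (Fin n)), Finset.mem_univ _⟩
            (fun sp : (Fin n → Fin m) × Equiv.Perm (Fin n) =>
              ∑ j, finish (A (sp.1 j))
                (∑ k ∈ Finset.univ.filter (fun k => sp.1 k = sp.1 j ∧ sp.2 k ≤ sp.2 j), p k)) := by
  have hm : 0 < m := hm1.trans hm1m
  let P : ℕ → ℝ := fun k => if h : k < n then p ⟨k, h⟩ else 0
  have hpP : ∀ j : Fin n, p j = P j := fun j => by simp [P]
  have hP : ∀ j, 0 ≤ P j := fun j => by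
    by_cases h : j < n
    · simpa [P, h] using (hp ⟨j, h⟩).le
    · simp [P, h]
  have hPmono : ∀ j k, j ≤ k → k < n → P j ≤ P k := fun j k hjk hk => by
    simpa [P, hk, hjk.trans_lt hk] using hSPT ⟨j, hjk.trans_lt hk⟩ ⟨k, hk⟩ hjk
  have hex : ∀ (i : Fin m) (w : ℝ), ∃ t, 0 ≤ t ∧ w ≤ A i t := fun i w => by
    by_cases hi : (i : ℕ) < m1
    · exact exists_le_of_growth he0 (hA0 i) (hAlo i hi) w
    · exact (((Filter.eventually_ge_atTop 0).and
        ((htop i (not_lt.1 hi)).eventually_ge_atTop w)).exists)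
  let c : ℕ := ⌈(m : ℝ) / (m1 : ℝ)⌉₊
  have hc : ((⌈(m : ℝ) / (m1 : ℝ)⌉ : ℤ) : ℝ) = (c : ℝ) :=
    (natCast_ceil_eq_intCast_ceil (by positivity)).symm
  have hmc : m ≤ c * m1 := by
    have h1 : (m : ℝ) / m1 ≤ c := Nat.le_ceil _
    rw [div_le_iff₀ (by exact_mod_cast hm1)] at h1
    exact_mod_cast h1
  obtain ⟨⟨τ, π⟩, -, hsp⟩ := Finset.exists_mem_eq_inf'
    (⟨(fun _ => ⟨0, hm⟩, Equiv.refl (Fin n)), Finset.mem_univ _⟩ :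
      (Finset.univ : Finset ((Fin n → Fin m) × Equiv.Perm (Fin n))).Nonempty)
    (fun sp : (Fin n → Fin m) × Equiv.Perm (Fin n) => ∑ j, finish (A (sp.1 j))
      (∑ k ∈ Finset.univ.filter (fun k => sp.1 k = sp.1 j ∧ sp.2 k ≤ sp.2 j), p k))
  rw [hsp, hc]
  calc ∑ k, finish (A (σ k)) (prefLoad p σ (σ k) k + p k)
      ≤ ∑ k : Fin n, roundRobin P m1 k / e0 := Finset.sum_le_sum fun k _ =>
        finish_ect_le_roundRobin hm1 hm1m he0 hA0 hAlo hP hPmono hpP hECT k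
    _ = (∑ k ∈ Finset.range n, roundRobin P m1 k) / e0 := by
        rw [← Finset.sum_div, Finset.sum_range]
    _ ≤ (c * ∑ k : Fin n, p k * (((n - 1 - k) / m : ℕ) + 1 : ℝ)) / e0 := by
        gcongr
        refine (sum_roundRobin_le hP hm1 n).trans ?_
        rw [Finset.sum_range, Finset.mul_sum]
        refine Finset.sum_le_sum fun k _ => ?_
        rw [← hpP k, mul_left_comm]
        refine mul_le_mul_of_nonneg_left ?_ (hp k).le
        exact_mod_cast Nat.div_add_one_le_mul_div_add_one hm1 hm hmc (n - 1 - k)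
    _ ≤ (c * ∑ j, finish (A (τ j))
          (∑ k ∈ Finset.univ.filter (fun k => τ k = τ j ∧ π k ≤ π j), p k)) / e0 := by
        refine div_le_div_of_nonneg_right (mul_le_mul_of_nonneg_left ?_ c.cast_nonneg) he0.le
        exact (sum_mul_le_sum_completion τ π (fun j => (hp j).le) fun a b => hSPT a b).trans
          (Finset.sum_le_sum fun j _ => le_finish_s16 (hA0 _) (hAub _) (hex _ _))
    _ = _ := by ring
end
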